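/- arXiv:2204.13218 — 3 statements merged into one kernel-verified Lean document; each statement's English description precedes it below -/
import Mathlib

section
/- Let ℐ ⊆ 𝒥 be an isotropic subspace and t ∈ ℝ. Then the subspaces ℐ(t) := {J(t) : J ∈ ℐ} and D(ℐ_t⁰)(t) := {J'(t) : J ∈ ℐ, J(t) = 0} of E are mutually orthogonal, and dim ℐ(t) + dim D(ℐ_t⁰)(t) = dim ℐ. (Thus the fiber V_t := ℐ(t) ⊕ D(ℐ_t⁰)(t) of the vertical bundle associated with ℐ has dimension dim ℐ for every t.) -/
open scoped RealInnerProductSpace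

noncomputable section

/-- Euclidean space `ℝ^n`. -/
abbrev Euc (n : ℕ) := EuclideanSpace ℝ (Fin n)

/-- `J : ℝ → ℝ^n` is a Jacobi field for the curvature family `R`:
it is twice differentiable and satisfies `J'' + R J = 0`. -/
def IsJacobi {n : ℕ} (R : ℝ → (Euc n →L[ℝ] Euc n)) (J : ℝ → Euc n) : Prop :=
  Differentiable ℝ J ∧ Differentiable ℝ (deriv J) ∧
    ∀ t : ℝ, deriv (deriv J) t + R t (J t) = 0

/-- The (candidate) symplectic pairing of two fields, evaluated at time `t`. -/
def om {n : ℕ} (J₁ J₂ : ℝ → Euc n) (t : ℝ) : ℝ :=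
  ⟪deriv J₁ t, J₂ t⟫ - ⟪J₁ t, deriv J₂ t⟫

namespace IsJacobi

variable {n : ℕ} {R : ℝ → (Euc n →L[ℝ] Euc n)} {J J₁ J₂ : ℝ → Euc n}

theorem deriv_deriv_eq (hJ : IsJacobi R J) (t : ℝ) : deriv (deriv J) t = -R t (J t) :=
  eq_neg_of_add_eq_zero_left (hJ.2.2 t)

/-- The symplectic pairing of two Jacobi fields does not depend on time. -/
theorem om_eq (hRsym : ∀ t : ℝ, ∀ v w : Euc n, ⟪R t v, w⟫ = ⟪v, R t w⟫)
    (h₁ : IsJacobi R J₁) (h₂ : IsJacobi R J₂) (s t : ℝ) : om J₁ J₂ s = om J₁ J₂ t := by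
  have key : ∀ x, HasDerivAt (om J₁ J₂) 0 x := by
    intro x
    have hd := ((h₁.2.1 x).hasDerivAt.inner ℝ (h₂.1 x).hasDerivAt).sub
      ((h₁.1 x).hasDerivAt.inner ℝ (h₂.2.1 x).hasDerivAt)
    refine hd.congr_deriv ?_
    rw [h₁.deriv_deriv_eq, h₂.deriv_deriv_eq, inner_neg_left, inner_neg_right, hRsym]
    ring
  exact is_const_of_deriv_eq_zero (fun x => (key x).differentiableAt) (fun x => (key x).deriv) s t

/-- A Jacobi field with vanishing initial data at some time vanishes identically. -/
theorem eq_zero_of_initial (hRcont : Continuous R) (hJ : IsJacobi R J) {t : ℝ}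
    (h₀ : J t = 0) (h₁ : deriv J t = 0) : J = 0 := by
  let L : ℝ → (Euc n × Euc n →L[ℝ] Euc n × Euc n) := fun s =>
    (ContinuousLinearMap.snd ℝ (Euc n) (Euc n)).prod
      (-(R s).comp (ContinuousLinearMap.fst ℝ (Euc n) (Euc n)))
  have hL : ∀ s, ‖L s‖ ≤ max 1 ‖R s‖ := by
    intro s
    refine ContinuousLinearMap.opNorm_le_bound _ (by positivity) fun x => ?_
    refine max_le ?_ ?_
    · exact (norm_snd_le x).trans (le_mul_of_one_le_left (norm_nonneg x) (le_max_left _ _))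
    · change ‖-(R s x.1)‖ ≤ _
      rw [norm_neg]
      exact ((R s).le_opNorm x.1).trans
        (mul_le_mul (le_max_right _ _) (norm_fst_le x) (norm_nonneg _) (by positivity))
  funext s
  obtain ⟨a, b, hs, ht⟩ : ∃ a b, s ∈ Set.Ioo a b ∧ t ∈ Set.Ioo a b :=
    ⟨min s t - 1, max s t + 1, by grind, by grind⟩
  obtain ⟨C, hC⟩ := (isCompact_Icc (a := a) (b := b)).exists_bound_of_continuousOn
    hRcont.continuousOn
  have hEq := ODE_solution_unique_of_mem_Ioo (v := fun s x => L s x) (s := fun _ => Set.univ)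
    (K := (max 1 C).toNNReal) (f := fun s => (J s, deriv J s)) (g := fun _ => 0) (t₀ := t)
    (a := a) (b := b)
    (fun r hr => by
      refine ((L r).lipschitz.weaken ?_).lipschitzOnWith
      rw [← NNReal.coe_le_coe, coe_nnnorm, Real.coe_toNNReal _ (by positivity)]
      exact (hL r).trans (max_le_max le_rfl (hC r (Set.Ioo_subset_Icc_self hr))))
    ht
    (fun r _ => by
      refine ⟨?_, Set.mem_univ _⟩
      have hd := (hJ.1 r).hasDerivAt.prodMk (hJ.2.1 r).hasDerivAt
      rwa [hJ.deriv_deriv_eq] at hd)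
    (fun r _ => by
      refine ⟨?_, Set.mem_univ _⟩
      simpa using hasDerivAt_const r (0 : Euc n × Euc n))
    (by simp [h₀, h₁])
  exact congrArg Prod.fst (hEq hs)

end IsJacobi

/-- Initial data `(J t, J' t)` as a linear map on a space of differentiable fields. -/
def initialData {n : ℕ} (ℐ : Submodule ℝ (ℝ → Euc n)) (hℐ : ∀ J ∈ ℐ, Differentiable ℝ J)
    (t : ℝ) : ℐ →ₗ[ℝ] Euc n × Euc n where
  toFun J := (J.1 t, deriv J.1 t)
  map_add' J₁ J₂ := Prod.ext rfl (deriv_add (hℐ _ J₁.2 t) (hℐ _ J₂.2 t))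
  map_smul' c J := Prod.ext rfl (deriv_const_smul c (hℐ _ J.2 t))

theorem stmt_4 {n : ℕ} (hn : 1 ≤ n) (R : ℝ → (Euc n →L[ℝ] Euc n))
    (hRcont : Continuous R)
    (hRsym : ∀ t : ℝ, ∀ v w : Euc n, ⟪R t v, w⟫ = ⟪v, R t w⟫)
    (ℐ : Submodule ℝ (ℝ → Euc n))
    (hℐJ : ∀ J ∈ ℐ, IsJacobi R J)
    (hiso : ∀ J₁ ∈ ℐ, ∀ J₂ ∈ ℐ, om J₁ J₂ 0 = 0) (t : ℝ) :
    (∀ J₁ ∈ ℐ, ∀ J₂ ∈ ℐ, J₂ t = 0 → ⟪J₁ t, deriv J₂ t⟫ = 0) ∧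
    Module.finrank ℝ (Submodule.span ℝ {v : Euc n | ∃ J ∈ ℐ, J t = v}) +
      Module.finrank ℝ (Submodule.span ℝ {w : Euc n | ∃ J ∈ ℐ, J t = 0 ∧ deriv J t = w}) =
      Module.finrank ℝ ℐ := by
  refine ⟨fun J₁ h₁ J₂ h₂ h₀ => ?_, ?_⟩
  · have h := ((hℐJ J₁ h₁).om_eq hRsym (hℐJ J₂ h₂) t 0).trans (hiso J₁ h₁ J₂ h₂)
    simpa [om, h₀] using h
  · let Φ := initialData ℐ (fun J hJ => (hℐJ J hJ).1) t
    have hΦ : Function.Injective Φ := by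
      rw [← LinearMap.ker_eq_bot, LinearMap.ker_eq_bot']
      intro J hJ
      exact Subtype.ext ((hℐJ J.1 J.2).eq_zero_of_initial hRcont
        (congrArg Prod.fst hJ) (congrArg Prod.snd hJ))
    have : FiniteDimensional ℝ ℐ := FiniteDimensional.of_injective Φ hΦ
    let ev := LinearMap.fst ℝ (Euc n) (Euc n) ∘ₗ Φ
    let D := (LinearMap.snd ℝ (Euc n) (Euc n) ∘ₗ Φ) ∘ₗ (LinearMap.ker ev).subtype
    have hD : Function.Injective D := by
      intro J₁ J₂ h
      exact Subtype.ext (hΦ (Prod.ext (J₁.2.trans J₂.2.symm) h))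
    have hev : Submodule.span ℝ {v : Euc n | ∃ J ∈ ℐ, J t = v} = LinearMap.range ev := by
      rw [← Submodule.span_eq (LinearMap.range ev)]
      congr 1
      ext v
      exact ⟨fun ⟨J, hJ, h⟩ => ⟨⟨J, hJ⟩, h⟩, fun ⟨J, h⟩ => ⟨J.1, J.2, h⟩⟩
    have hrange : Submodule.span ℝ {w : Euc n | ∃ J ∈ ℐ, J t = 0 ∧ deriv J t = w} =
        LinearMap.range D := by
      rw [← Submodule.span_eq (LinearMap.range D)]
      congr 1
      ext w
      exact ⟨fun ⟨J, hJ, h, hw⟩ => ⟨⟨⟨J, hJ⟩, h⟩, hw⟩, fun ⟨J, h⟩ => ⟨J.1.1, J.1.2, J.2, h⟩⟩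
    rw [hev, hrange, LinearMap.finrank_range_of_inj hD, ev.finrank_range_add_finrank_ker]
end
end

section
/- Fix a ∈ ℝ, a linear subspace V₀ ⊆ E, and a linear map T : E → E satisfying ⟨T v₁, v₂⟩ = ⟨v₁, T v₂⟩ for all v₁, v₂ ∈ V₀. Then the space of holonomy-type Jacobi fields ℐ := {J ∈ 𝒥 : J(a) ∈ V₀ and J'(a) = T(J(a))} is an isotropic subspace of 𝒥 with dim ℐ = dim V₀. -/
open scoped RealInnerProductSpace

noncomputable section

/-- The set of holonomy-type Jacobi fields. -/
def holJac {n : ℕ} (R : ℝ → (Euc n →L[ℝ] Euc n)) (a : ℝ) (V₀ : Submodule ℝ (Euc n))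
    (T : Euc n →ₗ[ℝ] Euc n) : Set (ℝ → Euc n) :=
  {J : ℝ → Euc n | IsJacobi R J ∧ J a ∈ V₀ ∧ deriv J a = T (J a)}

open MeasureTheory Set Metric

section LinearODE

variable {F : Type*} [NormedAddCommGroup F] [NormedSpace ℝ F]

/-- The terms of the Picard (Peano–Baker) series solving `x' = A x`, `x a = x₀`. -/
def picardTerm (A : ℝ → F →L[ℝ] F) (a : ℝ) (x₀ : F) : ℕ → ℝ → F
  | 0 => fun _ => x₀
  | k + 1 => fun t => ∫ s in a..t, A s (picardTerm A a x₀ k s)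

variable {A : ℝ → F →L[ℝ] F} {a : ℝ} {x₀ : F}

lemma norm_picardTerm_le {M r : ℝ} (hM : ∀ t ∈ closedBall a r, ‖A t‖ ≤ M) (k : ℕ) :
    ∀ t ∈ closedBall a r,
      ‖picardTerm A a x₀ k t‖ ≤ ‖x₀‖ * M ^ k / k.factorial * |t - a| ^ k := by
  induction k with
  | zero => intro t _; simp [picardTerm]
  | succ k ih =>
    intro t ht
    have hM0 : 0 ≤ M := (norm_nonneg _).trans (hM t ht)
    have hsub : ∀ s ∈ uIoc a t, s ∈ closedBall a r := by
      intro s hs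
      rw [mem_closedBall, Real.dist_eq] at ht ⊢
      exact (abs_sub_left_of_mem_uIcc (uIoc_subset_uIcc hs)).trans ht
    have hbound : ∀ s ∈ uIoc a t, ‖A s (picardTerm A a x₀ k s)‖ ≤
        M * (‖x₀‖ * M ^ k / k.factorial) * |s - a| ^ k := by
      intro s hs
      rw [mul_assoc]
      exact (A s).le_of_opNorm_le_of_le (hM s (hsub s hs)) (ih s (hsub s hs))
    have hint : IntegrableOn (fun s => M * (‖x₀‖ * M ^ k / k.factorial) * |s - a| ^ k)
        (uIoc a t) :=
      (Continuous.integrableOn_uIcc (by fun_prop)).mono_set uIoc_subset_uIcc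
    calc ‖picardTerm A a x₀ (k + 1) t‖
        ≤ ∫ s in uIoc a t, ‖A s (picardTerm A a x₀ k s)‖ :=
          intervalIntegral.norm_integral_le_integral_norm_uIoc
      _ ≤ ∫ s in uIoc a t, M * (‖x₀‖ * M ^ k / k.factorial) * |s - a| ^ k :=
          integral_mono_of_nonneg (.of_forall fun _ => norm_nonneg _) hint
            ((ae_restrict_iff' measurableSet_uIoc).2 (.of_forall hbound))
      _ = ‖x₀‖ * M ^ (k + 1) / (k + 1).factorial * |t - a| ^ (k + 1) := by
          rw [integral_const_mul, integral_pow_abs_sub_uIoc, Nat.factorial_succ]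
          push_cast
          field_simp
          ring

lemma continuous_picardTerm (hA : Continuous A) (k : ℕ) :
    Continuous (picardTerm A a x₀ k) := by
  induction k with
  | zero => exact continuous_const
  | succ k ih =>
    exact intervalIntegral.continuous_primitive
      (fun _ _ => (hA.clm_apply ih).intervalIntegrable _ _) a

variable [CompleteSpace F]

lemma hasDerivAt_picardTerm_succ (hA : Continuous A) (k : ℕ) (t : ℝ) :
    HasDerivAt (picardTerm A a x₀ (k + 1)) (A t (picardTerm A a x₀ k t)) t :=
  (hA.clm_apply (continuous_picardTerm hA k)).integral_hasStrictDerivAt a t |>.hasDerivAt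

/-- A linear ODE with continuous coefficients on `ℝ` has a global solution for every initial
value. -/
theorem exists_hasDerivAt_linear (hA : Continuous A) (a : ℝ) (x₀ : F) :
    ∃ x : ℝ → F, x a = x₀ ∧ ∀ t, HasDerivAt x (A t (x t)) t := by
  have hsucc_a : ∀ k, picardTerm A a x₀ (k + 1) a = 0 := fun k => by simp [picardTerm]
  have hbounds : ∀ r : ℝ, ∃ M : ℝ, ∀ t ∈ closedBall a r, ‖A t‖ ≤ M := fun r =>
    (isCompact_closedBall a r).exists_bound_of_continuousOn hA.continuousOn
  have key : ∀ r : ℝ, 0 < r → ∃ u : ℕ → ℝ, Summable u ∧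
      ∀ k, ∀ t ∈ closedBall a r, ‖picardTerm A a x₀ k t‖ ≤ u k := by
    intro r hr
    obtain ⟨M, hM⟩ := hbounds r
    have hM0 : 0 ≤ M := (norm_nonneg _).trans (hM a (mem_closedBall_self hr.le))
    refine ⟨fun k => ‖x₀‖ * ((M * r) ^ k / k.factorial),
      (Real.summable_pow_div_factorial _).mul_left _, fun k t ht => ?_⟩
    refine (norm_picardTerm_le hM k t ht).trans ?_
    rw [mem_closedBall, Real.dist_eq] at ht
    calc ‖x₀‖ * M ^ k / k.factorial * |t - a| ^ k
        ≤ ‖x₀‖ * M ^ k / k.factorial * r ^ k := by gcongr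
      _ = ‖x₀‖ * ((M * r) ^ k / k.factorial) := by rw [mul_pow]; ring
  have hsum : ∀ t, Summable fun k => picardTerm A a x₀ k t := by
    intro t
    obtain ⟨u, hu, hle⟩ := key (|t - a| + 1) (by positivity)
    exact .of_norm_bounded hu fun k => hle k t (by
      rw [mem_closedBall, Real.dist_eq]; linarith)
  have hsplit : ∀ t, ∑' k, picardTerm A a x₀ k t =
      x₀ + ∑' k, picardTerm A a x₀ (k + 1) t := fun t => (hsum t).tsum_eq_zero_add
  refine ⟨fun t => ∑' k, picardTerm A a x₀ k t, by simp [hsplit, hsucc_a], fun t => ?_⟩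
  set r := |t - a| + 1 with hr
  have hr0 : 0 < r := by positivity
  obtain ⟨u, hu, hle⟩ := key r hr0
  obtain ⟨M, hM⟩ := hbounds r
  have hderiv := hasDerivAt_tsum_of_isPreconnected (hu.mul_left M) (isOpen_ball (x := a) (ε := r))
    (convex_ball a r).isPreconnected
    (fun k s _ => hasDerivAt_picardTerm_succ (x₀ := x₀) (a := a) hA k s)
    (fun k s hs => (A s).le_of_opNorm_le_of_le (hM s (ball_subset_closedBall hs))
      (hle k s (ball_subset_closedBall hs)))
    (mem_ball_self hr0) (by simp [hsucc_a])
    (show t ∈ ball a r by rw [mem_ball, Real.dist_eq]; linarith)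
  simp_rw [hsplit]
  rw [← hsplit, (A t).map_tsum (hsum t)]
  exact hderiv.const_add x₀

end LinearODE

section Jacobi

variable {n : ℕ} {R : ℝ → (Euc n →L[ℝ] Euc n)} {J J₁ J₂ : ℝ → Euc n}

lemma IsJacobi.hasDerivAt (h : IsJacobi R J) (t : ℝ) : HasDerivAt J (deriv J t) t :=
  (h.1 t).hasDerivAt

lemma IsJacobi.hasDerivAt_deriv (h : IsJacobi R J) (t : ℝ) :
    HasDerivAt (deriv J) (-R t (J t)) t := by
  rw [← eq_neg_of_add_eq_zero_left (h.2.2 t)]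
  exact (h.2.1 t).hasDerivAt

lemma isJacobi_of_hasDerivAt {K : ℝ → Euc n} (hJ : ∀ t, HasDerivAt J (K t) t)
    (hK : ∀ t, HasDerivAt K (-R t (J t)) t) : IsJacobi R J := by
  have hd : deriv J = K := funext fun t => (hJ t).deriv
  refine ⟨fun t => (hJ t).differentiableAt, ?_, fun t => ?_⟩
  · rw [hd]
    exact fun t => (hK t).differentiableAt
  · rw [hd, (hK t).deriv, neg_add_cancel]

lemma IsJacobi.zero : IsJacobi R 0 :=
  isJacobi_of_hasDerivAt (K := 0) (fun t => hasDerivAt_const t 0) fun t =>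
    (hasDerivAt_const t (0 : Euc n)).congr_deriv (by simp)

lemma IsJacobi.add (h₁ : IsJacobi R J₁) (h₂ : IsJacobi R J₂) : IsJacobi R (J₁ + J₂) :=
  isJacobi_of_hasDerivAt (fun t => (h₁.hasDerivAt t).add (h₂.hasDerivAt t)) fun t =>
    ((h₁.hasDerivAt_deriv t).add (h₂.hasDerivAt_deriv t)).congr_deriv (by
      rw [Pi.add_apply, map_add, neg_add])

lemma IsJacobi.const_smul (c : ℝ) (h : IsJacobi R J) : IsJacobi R (c • J) :=
  isJacobi_of_hasDerivAt (fun t => (h.hasDerivAt t).const_smul c) fun t =>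
    ((h.hasDerivAt_deriv t).const_smul c).congr_deriv (by
      rw [Pi.smul_apply, map_smul, smul_neg])

/-- There is a Jacobi field with any prescribed value and derivative at a given time. -/
theorem exists_isJacobi (hR : Continuous R) (a : ℝ) (v w : Euc n) :
    ∃ J, IsJacobi R J ∧ J a = v ∧ deriv J a = w := by
  let A : ℝ → (Euc n × Euc n →L[ℝ] Euc n × Euc n) := fun t =>
    ContinuousLinearMap.inl ℝ (Euc n) (Euc n) ∘L ContinuousLinearMap.snd ℝ (Euc n) (Euc n) -
      ContinuousLinearMap.inr ℝ (Euc n) (Euc n) ∘L R t ∘L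
        ContinuousLinearMap.fst ℝ (Euc n) (Euc n)
  have hA : Continuous A := continuous_const.sub
    (continuous_const.clm_comp (hR.clm_comp continuous_const))
  obtain ⟨x, hxa, hx⟩ := exists_hasDerivAt_linear hA a (v, w)
  have hfst : ∀ t, HasDerivAt (fun s => (x s).1) (x t).2 t := fun t =>
    ((ContinuousLinearMap.fst ℝ (Euc n) (Euc n)).hasFDerivAt.comp_hasDerivAt t
      (hx t)).congr_deriv (by simp [A])
  have hsnd : ∀ t, HasDerivAt (fun s => (x s).2) (-R t (x t).1) t := fun t =>
    ((ContinuousLinearMap.snd ℝ (Euc n) (Euc n)).hasFDerivAt.comp_hasDerivAt t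
      (hx t)).congr_deriv (by simp [A])
  exact ⟨_, isJacobi_of_hasDerivAt hfst hsnd, by simp [hxa], by simp [(hfst a).deriv, hxa]⟩

/-- The symplectic form of two Jacobi fields does not depend on time. -/
theorem IsJacobi.om_eq_s6 (hR : ∀ t : ℝ, ∀ v w : Euc n, ⟪R t v, w⟫ = ⟪v, R t w⟫)
    (h₁ : IsJacobi R J₁) (h₂ : IsJacobi R J₂) (s t : ℝ) : om J₁ J₂ s = om J₁ J₂ t := by
  have hd : ∀ t, HasDerivAt (om J₁ J₂) 0 t := fun t =>
    (((h₁.hasDerivAt_deriv t).inner ℝ (h₂.hasDerivAt t)).sub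
      ((h₁.hasDerivAt t).inner ℝ (h₂.hasDerivAt_deriv t))).congr_deriv (by
        rw [inner_neg_left, inner_neg_right, hR]; ring)
  exact is_const_of_deriv_eq_zero (fun t => (hd t).differentiableAt) (fun t => (hd t).deriv) s t

/-- A Jacobi field is determined by its value and derivative at one time. -/
theorem IsJacobi.eq_zero (hRcont : Continuous R)
    (hR : ∀ t : ℝ, ∀ v w : Euc n, ⟪R t v, w⟫ = ⟪v, R t w⟫) (h : IsJacobi R J) {a : ℝ}
    (ha : J a = 0) (ha' : deriv J a = 0) : J = 0 := by
  funext t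
  obtain ⟨K, hK, hKt, hKt'⟩ := exists_isJacobi hRcont t 0 (J t)
  have hom := h.om_eq_s6 hR hK t a
  simpa [om, ha, ha', hKt, hKt'] using hom

/-- The holonomy-type Jacobi fields as a subspace of the space of all maps. -/
def holJacSubmodule (R : ℝ → (Euc n →L[ℝ] Euc n)) (a : ℝ) (V₀ : Submodule ℝ (Euc n))
    (T : Euc n →ₗ[ℝ] Euc n) : Submodule ℝ (ℝ → Euc n) where
  carrier := holJac R a V₀ T
  zero_mem' := ⟨.zero, by simp, by simp⟩
  add_mem' := by
    rintro J₁ J₂ ⟨h₁, hV₁, hT₁⟩ ⟨h₂, hV₂, hT₂⟩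
    refine ⟨h₁.add h₂, V₀.add_mem hV₁ hV₂, ?_⟩
    rw [deriv_add (h₁.1 a) (h₂.1 a), hT₁, hT₂, Pi.add_apply, map_add]
  smul_mem' := by
    rintro c J ⟨h, hV, hT⟩
    refine ⟨h.const_smul c, V₀.smul_mem c hV, ?_⟩
    rw [deriv_const_smul c (h.1 a), hT, Pi.smul_apply, map_smul]

/-- Evaluation at the base time, as a linear map onto the space of initial values. -/
def holJacEval (R : ℝ → (Euc n →L[ℝ] Euc n)) (a : ℝ) (V₀ : Submodule ℝ (Euc n))
    (T : Euc n →ₗ[ℝ] Euc n) : holJacSubmodule R a V₀ T →ₗ[ℝ] V₀ :=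
  ((LinearMap.proj a).comp (holJacSubmodule R a V₀ T).subtype).codRestrict V₀ fun J => J.2.2.1

theorem holJacEval_bijective (hRcont : Continuous R)
    (hR : ∀ t : ℝ, ∀ v w : Euc n, ⟪R t v, w⟫ = ⟪v, R t w⟫) (a : ℝ)
    (V₀ : Submodule ℝ (Euc n)) (T : Euc n →ₗ[ℝ] Euc n) :
    Function.Bijective (holJacEval R a V₀ T) := by
  constructor
  · rw [injective_iff_map_eq_zero]
    rintro ⟨J, hJ, hV, hT⟩ h0
    have ha : J a = 0 := congrArg Subtype.val h0
    exact Subtype.ext (hJ.eq_zero hRcont hR ha (by rw [hT, ha, map_zero]))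
  · rintro ⟨v, hv⟩
    obtain ⟨J, hJ, hJa, hJa'⟩ := exists_isJacobi hRcont a v (T v)
    exact ⟨⟨J, hJ, by rwa [hJa], by rw [hJa', hJa]⟩, Subtype.ext hJa⟩

end Jacobi

theorem stmt_6 {n : ℕ} (hn : 1 ≤ n) (R : ℝ → (Euc n →L[ℝ] Euc n))
    (hRcont : Continuous R)
    (hRsym : ∀ t : ℝ, ∀ v w : Euc n, ⟪R t v, w⟫ = ⟪v, R t w⟫)
    (a : ℝ) (V₀ : Submodule ℝ (Euc n)) (T : Euc n →ₗ[ℝ] Euc n)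
    (hT : ∀ v₁ ∈ V₀, ∀ v₂ ∈ V₀, ⟪T v₁, v₂⟫ = ⟪v₁, T v₂⟫) :
    (∀ J₁ ∈ holJac R a V₀ T, ∀ J₂ ∈ holJac R a V₀ T, om J₁ J₂ 0 = 0) ∧
    Module.finrank ℝ (Submodule.span ℝ (holJac R a V₀ T)) = Module.finrank ℝ V₀ := by
  refine ⟨?_, ?_⟩
  · rintro J₁ ⟨h₁, hV₁, hT₁⟩ J₂ ⟨h₂, hV₂, hT₂⟩
    rw [h₁.om_eq_s6 hRsym h₂ 0 a, om, hT₁, hT₂, hT _ hV₁ _ hV₂, sub_self]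
  · have hspan : Submodule.span ℝ (holJac R a V₀ T) = holJacSubmodule R a V₀ T :=
      Submodule.span_eq (holJacSubmodule R a V₀ T)
    rw [hspan]
    exact (LinearEquiv.ofBijective _ (holJacEval_bijective hRcont hRsym a V₀ T)).finrank_eq
end
end

section
/- (Wilking's decomposition lemma.) Suppose in addition that R(t) is positive semidefinite for every t ∈ ℝ, i.e. ⟨R(t)v, v⟩ ≥ 0 for all v ∈ E and t ∈ ℝ. Let L ⊆ 𝒥 be a Lagrangian subspace. Then L is the internal direct sum of ℐ := span{J ∈ L : J(t) = 0 for some t ∈ ℝ} and P := {J ∈ L : J is constant}; that is, ℐ ∩ P = {0} and ℐ + P = L. -/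
open scoped RealInnerProductSpace

noncomputable section

open Set Filter Topology

/-- Second-order necessary condition at a local minimum. -/
theorem IsLocalMin.deriv_deriv_nonneg {h : ℝ → ℝ} {t : ℝ} (hmin : IsLocalMin h t)
    (hc : ContinuousAt h t) : 0 ≤ deriv (deriv h) t := by
  by_contra! hneg
  have hmax := isLocalMax_of_deriv_deriv_neg hneg hmin.deriv_eq_zero hc
  have hconst : h =ᶠ[𝓝 t] fun _ => h t := by
    filter_upwards [hmin, hmax] with s h₁ h₂ using le_antisymm h₂ h₁
  have hzero : deriv (deriv h) t = 0 := by
    rw [hconst.deriv.deriv_eq]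
    simp
  exact hneg.ne hzero

/-- A comparison function `ψ` for `f ^ 2` at `t`, whose square root has nonpositive second
derivative at `t`. -/
structure IsConcaveBarrier (f ψ : ℝ → ℝ) (t : ℝ) : Prop where
  differentiable : Differentiable ℝ ψ
  differentiableAt_deriv : DifferentiableAt ℝ (deriv ψ) t
  sq_le : ∀ s, f s ^ 2 ≤ ψ s
  eq_sq : ψ t = f t ^ 2
  two_mul_le : 2 * ψ t * deriv (deriv ψ) t ≤ deriv ψ t ^ 2

/-- Minimum principle: a positive function with concave barriers cannot touch a strictly convex
parabola from above. -/
theorem IsConcaveBarrier.not_isLocalMin_sub_quadratic {f ψ : ℝ → ℝ} {t : ℝ}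
    (hψ : IsConcaveBarrier f ψ t) (hpos : 0 < f t) {A B ε : ℝ} (hε : 0 < ε) :
    ¬ IsLocalMin (fun s => f s - (A + B * s + ε * s ^ 2)) t := by
  intro hmin
  set C := f t - (B * t + ε * t ^ 2) with hC
  set Q : ℝ → ℝ := fun s => C + B * s + ε * s ^ 2 with hQ
  have hQt : Q t = f t := by simp only [hQ, hC]; ring
  have hQd : ∀ s, HasDerivAt Q (B + ε * (2 * s)) s := by
    intro s
    have h₁ : HasDerivAt (fun s : ℝ => C + B * s + ε * s ^ 2) (B * 1 + ε * (2 * s)) s := by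
      refine (((hasDerivAt_id s).const_mul B).const_add C).add ?_
      simpa using (hasDerivAt_pow 2 s).const_mul ε
    simpa using h₁
  have hd : ∀ s, HasDerivAt (fun s => ψ s - Q s ^ 2)
      (deriv ψ s - 2 * Q s * (B + ε * (2 * s))) s := by
    intro s
    have := (hψ.differentiable s).hasDerivAt.sub ((hQd s).pow 2)
    convert! this using 1
    simp
  have hloc : IsLocalMin (fun s => ψ s - Q s ^ 2) t := by
    have hQpos : ∀ᶠ s in 𝓝 t, 0 < Q s :=
      (hQd t).continuousAt.eventually (lt_mem_nhds (by rwa [hQt]))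
    filter_upwards [hmin, hQpos] with s h₁ h₂
    have h₃ : Q s ≤ f s := by simp only [hQ, hC]; linarith
    have h₄ : Q s ^ 2 ≤ f s ^ 2 := by gcongr
    have h₅ := hψ.sq_le s
    rw [hQt, hψ.eq_sq]
    linarith
  have hfirst := hloc.hasDerivAt_eq_zero (hd t)
  have hsecond := hloc.deriv_deriv_nonneg (hd t).continuousAt
  have hlin : HasDerivAt (fun s : ℝ => B + ε * (2 * s)) (ε * 2) t := by
    simpa using (((hasDerivAt_id t).const_mul 2).const_mul ε).const_add B
  have hdd := hψ.differentiableAt_deriv.hasDerivAt.sub (((hQd t).const_mul 2).mul hlin)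
  rw [show deriv (fun s => ψ s - Q s ^ 2) = fun s => deriv ψ s - 2 * Q s * (B + ε * (2 * s)) from
    funext fun s => (hd s).deriv] at hsecond
  have hval := hdd.deriv
  simp only [Pi.sub_def, Pi.mul_def] at hval
  rw [hval, hQt] at hsecond
  rw [hQt] at hfirst
  have hle := hψ.two_mul_le
  rw [hψ.eq_sq, sub_eq_zero.1 hfirst] at hle
  nlinarith [pow_pos hpos 3, mul_pos (pow_pos hpos 3) hε, mul_nonneg (sq_nonneg (f t)) hsecond]

/-- A positive lower semicontinuous function on the line with concave barriers everywhere is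
constant. -/
theorem eq_of_isConcaveBarrier {f : ℝ → ℝ} (hf : LowerSemicontinuous f) (hpos : ∀ t, 0 < f t)
    (hb : ∀ t, ∃ ψ, IsConcaveBarrier f ψ t) (x y : ℝ) : f x = f y := by
  have hquad : ∀ A B ε a b : ℝ, 0 < ε → a ≤ b → A + B * a + ε * a ^ 2 ≤ f a →
      A + B * b + ε * b ^ 2 ≤ f b → ∀ s ∈ Icc a b, A + B * s + ε * s ^ 2 ≤ f s := by
    intro A B ε a b hε hab ha hb' s hs
    have hlsc : LowerSemicontinuous fun s => f s + -(A + B * s + ε * s ^ 2) :=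
      hf.add (Continuous.lowerSemicontinuous (by fun_prop))
    obtain ⟨m, hm, hmin⟩ := LowerSemicontinuousOn.exists_isMinOn ⟨s, hs⟩ isCompact_Icc
      (hlsc.lowerSemicontinuousOn (Icc a b))
    have hms := hmin hs
    simp only [mem_ofPred_eq] at hms
    rcases eq_or_lt_of_le hm.1 with rfl | h₁
    · linarith
    rcases eq_or_lt_of_le hm.2 with rfl | h₂
    · linarith
    obtain ⟨ψ, hψ⟩ := hb m
    refine absurd ?_ (hψ.not_isLocalMin_sub_quadratic (hpos m) (A := A) (B := B) hε)
    simpa only [sub_eq_add_neg] using hmin.isLocalMin (Icc_mem_nhds h₁ h₂)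
  have hlin : ∀ A B a b : ℝ, a ≤ b → A + B * a ≤ f a → A + B * b ≤ f b →
      ∀ s ∈ Icc a b, A + B * s ≤ f s := by
    intro A B a b hab ha hb' s hs
    have hP : 0 ≤ (s - a) * (b - s) := mul_nonneg (sub_nonneg.2 hs.1) (sub_nonneg.2 hs.2)
    refine le_of_forall_pos_sub_le fun δ hδ => ?_
    have hP' : 0 < (s - a) * (b - s) + 1 := by linarith
    set ε := δ / ((s - a) * (b - s) + 1)
    have hε : 0 < ε := by positivity
    have hεδ : ε * ((s - a) * (b - s) + 1) = δ := div_mul_cancel₀ _ hP'.ne'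
    have := hquad (A + ε * (a * b)) (B - ε * (a + b)) ε a b hε hab
      (by nlinarith) (by nlinarith) s hs
    nlinarith
  have hle : ∀ x y, f y ≤ f x := by
    intro x y
    refine le_of_forall_pos_sub_le fun δ hδ => ?_
    have hy := hpos y
    rcases lt_trichotomy x y with hxy | rfl | hxy
    · have hm : 0 < δ / (y - x) := div_pos hδ (sub_pos.2 hxy)
      have h₁ : f y - δ / (y - x) * y + δ / (y - x) * x = f y - δ := by
        have : y - x ≠ 0 := (sub_pos.2 hxy).ne'
        field_simp
        ring
      rcases le_or_gt (f y) δ with h | h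
      · linarith [hpos x]
      set z := y - f y / (δ / (y - x))
      have hz : f y - δ / (y - x) * y + δ / (y - x) * z = 0 := by
        simp only [z]
        field_simp
        ring
      have hzx : z ≤ x := by
        by_contra! hlt
        nlinarith
      have := hlin (f y - δ / (y - x) * y) (δ / (y - x)) z y (by linarith)
        (by linarith [hpos z]) (by linarith) x ⟨hzx, hxy.le⟩
      linarith
    · linarith
    · have hm : 0 < δ / (x - y) := div_pos hδ (sub_pos.2 hxy)
      have h₁ : f y + δ / (x - y) * y - δ / (x - y) * x = f y - δ := by
        have : x - y ≠ 0 := (sub_pos.2 hxy).ne'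
        field_simp
        ring
      rcases le_or_gt (f y) δ with h | h
      · linarith [hpos x]
      set z := y + f y / (δ / (x - y))
      have hz : f y + δ / (x - y) * y - δ / (x - y) * z = 0 := by
        simp only [z]
        field_simp
        ring
      have hzx : x ≤ z := by
        by_contra! hlt
        nlinarith
      have := hlin (f y + δ / (x - y) * y) (-(δ / (x - y))) y z (by linarith)
        (by linarith) (by linarith [hpos z]) x ⟨hxy.le, hzx⟩
      linarith
  exact le_antisymm (hle y x) (hle x y)

/-- A Jacobi field is determined by its value and derivative at one time. -/
theorem IsJacobi.eq_zero_s13 {n : ℕ} {R : ℝ → (Euc n →L[ℝ] Euc n)} (hR : Continuous R)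
    {J : ℝ → Euc n} (hJ : IsJacobi R J) {t₀ : ℝ} (h₀ : J t₀ = 0) (h₁ : deriv J t₀ = 0) :
    J = 0 := by
  obtain ⟨hd, hdd, heq⟩ := hJ
  funext t
  set a := min t t₀ - 1
  set b := max t t₀ + 1
  have hat : a < t := by linarith [min_le_left t t₀]
  have hat₀ : a < t₀ := by linarith [min_le_right t t₀]
  have htb : t < b := by linarith [le_max_left t t₀]
  have ht₀b : t₀ < b := by linarith [le_max_right t t₀]
  obtain ⟨C, hC⟩ := isCompact_Icc.exists_bound_of_continuousOn (hR.continuousOn (s := Icc a b))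
  let v : ℝ → Euc n × Euc n → Euc n × Euc n := fun t p => (p.2, -R t p.1)
  have hLip : ∀ t ∈ Ioo a b, LipschitzOnWith (max 1 C.toNNReal) (v t) univ := by
    intro t ht
    rw [lipschitzOnWith_univ]
    refine LipschitzWith.prodMk (f := fun p : Euc n × Euc n => p.2) LipschitzWith.prod_snd ?_
    have h := ((R t).lipschitz.comp
      (LipschitzWith.prod_fst : LipschitzWith 1 (Prod.fst : Euc n × Euc n → Euc n))).neg
    refine h.weaken ?_
    rw [mul_one, ← NNReal.coe_le_coe]
    exact (hC t (Ioo_subset_Icc_self ht)).trans (Real.le_coe_toNNReal C)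
  have huniq := ODE_solution_unique_of_mem_Ioo (f := fun t => (J t, deriv J t))
    (g := fun _ => (0 : Euc n × Euc n)) hLip ⟨hat₀, ht₀b⟩
    (fun s _ => ⟨by
      have := (hd s).hasDerivAt.prodMk (hdd s).hasDerivAt
      rwa [eq_neg_of_add_eq_zero_left (heq s)] at this, mem_univ _⟩)
    (fun s _ => ⟨by
      convert! hasDerivAt_const s (0 : Euc n × Euc n)
      simp [v], mem_univ _⟩)
    (by simp [h₀, h₁])
  simpa using congrArg Prod.fst (huniq ⟨hat, htb⟩)

/-- A positive semidefinite symmetric operator annihilates its isotropic vectors. -/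
theorem apply_eq_zero_of_inner_self_eq_zero {E : Type*} [NormedAddCommGroup E]
    [InnerProductSpace ℝ E] {T : E →L[ℝ] E} (hsym : ∀ v w, ⟪T v, w⟫ = ⟪v, T w⟫)
    (hpos : ∀ v, 0 ≤ ⟪T v, v⟫) {v : E} (hv : ⟪T v, v⟫ = 0) : T v = 0 := by
  have key : ∀ x : ℝ, 0 ≤ 2 * x * ‖T v‖ ^ 2 + x ^ 2 * ⟪T (T v), T v⟫ := by
    intro x
    have h := hpos (v + x • T v)
    have h' : ⟪T (T v), v⟫ = ‖T v‖ ^ 2 := by rw [hsym, real_inner_self_eq_norm_sq]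
    simp only [map_add, map_smul, inner_add_left, inner_add_right, inner_smul_left,
      inner_smul_right, hv, h', real_inner_self_eq_norm_sq, conj_trivial] at h
    linarith
  set q := ⟪T (T v), T v⟫
  have hq : 0 ≤ q := hpos _
  have h := key (-‖T v‖ ^ 2 / (q + 1))
  have hq1 : 0 < q + 1 := by linarith
  have hval : 2 * (-‖T v‖ ^ 2 / (q + 1)) * ‖T v‖ ^ 2 + (-‖T v‖ ^ 2 / (q + 1)) ^ 2 * q
      = -((‖T v‖ ^ 2) ^ 2 * (q + 2)) / (q + 1) ^ 2 := by
    field_simp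
    ring
  rw [hval, le_div_iff₀ (by positivity)] at h
  have hsq : (‖T v‖ ^ 2) ^ 2 = 0 := by nlinarith [sq_nonneg (‖T v‖ ^ 2)]
  simpa using hsq

/-- A vector-valued function with vanishing first and second derivatives at `t` is constant up to
an error `o((s - t) ^ 2)`. -/
theorem eventually_norm_sub_le_mul_sq {E : Type*} [NormedAddCommGroup E] [NormedSpace ℝ E]
    {J : ℝ → E} (hd : Differentiable ℝ J) {t : ℝ} (h₁ : deriv J t = 0)
    (h₂ : HasDerivAt (deriv J) 0 t) {ε : ℝ} (hε : 0 < ε) :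
    ∀ᶠ s in 𝓝 t, ‖J s - J t‖ ≤ ε * ‖s - t‖ ^ 2 := by
  have hlo := (hasDerivAt_iff_isLittleO.1 h₂).def hε
  obtain ⟨δ, hδ, hball⟩ := Metric.eventually_nhds_iff_ball.1 hlo
  filter_upwards [Metric.ball_mem_nhds t hδ] with s hs
  have hsub : Metric.closedBall t ‖s - t‖ ⊆ Metric.ball t δ :=
    Metric.closedBall_subset_ball (by simpa [dist_eq_norm] using hs)
  have hbound : ∀ x ∈ Metric.closedBall t ‖s - t‖, ‖deriv J x‖ ≤ ε * ‖s - t‖ := by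
    intro x hx
    have := hball x (hsub hx)
    simp only [h₁, sub_zero, smul_zero] at this
    exact this.trans (by gcongr; simpa [dist_eq_norm] using hx)
  have := (convex_closedBall t ‖s - t‖).norm_image_sub_le_of_norm_deriv_le
    (fun x _ => hd x) hbound (Metric.mem_closedBall_self (norm_nonneg _))
    (show s ∈ Metric.closedBall t ‖s - t‖ by simp [dist_eq_norm])
  linarith

/-- The symplectic pairing of two Jacobi fields is independent of time. -/
theorem om_eq_om_zero {n : ℕ} {R : ℝ → (Euc n →L[ℝ] Euc n)}
    (hsym : ∀ t : ℝ, ∀ v w : Euc n, ⟪R t v, w⟫ = ⟪v, R t w⟫) {J₁ J₂ : ℝ → Euc n}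
    (h₁ : IsJacobi R J₁) (h₂ : IsJacobi R J₂) (t : ℝ) : om J₁ J₂ t = om J₁ J₂ 0 := by
  have hd : ∀ s, HasDerivAt (om J₁ J₂) 0 s := by
    intro s
    have h := ((h₁.2.1 s).hasDerivAt.inner ℝ (h₂.1 s).hasDerivAt).sub
      ((h₁.1 s).hasDerivAt.inner ℝ (h₂.2.1 s).hasDerivAt)
    rw [eq_neg_of_add_eq_zero_left (h₁.2.2 s), eq_neg_of_add_eq_zero_left (h₂.2.2 s)] at h
    convert! h using 1
    rw [inner_neg_left, inner_neg_right, hsym]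
    ring
  exact is_const_of_deriv_eq_zero (fun s => (hd s).differentiableAt) (fun s => (hd s).deriv) t 0

/-- `L` is a Lagrangian space of Jacobi fields for `R`. -/
structure IsLagrangian {n : ℕ} (R : ℝ → (Euc n →L[ℝ] Euc n)) (L : Submodule ℝ (ℝ → Euc n)) :
    Prop where
  jacobi : ∀ J : L, IsJacobi R J
  isotropic : ∀ (J₁ J₂ : L) (t : ℝ), ⟪deriv (J₁ : ℝ → Euc n) t, (J₂ : ℝ → Euc n) t⟫ =
    ⟪(J₁ : ℝ → Euc n) t, deriv (J₂ : ℝ → Euc n) t⟫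
  finiteDimensional : FiniteDimensional ℝ L
  finrank_eq : Module.finrank ℝ L = n

namespace IsLagrangian

variable {n : ℕ} {R : ℝ → (Euc n →L[ℝ] Euc n)} {L : Submodule ℝ (ℝ → Euc n)}

/-- Evaluation at `t` of the fields in `L`, with the fields in the range of `π` divided by
`t - t₀`. When `π` projects onto the fields vanishing at `t₀`, this desingularizes the evaluation
map near `t₀`. -/
def regularEval (hL : IsLagrangian R L) (π : L →ₗ[ℝ] L) (t₀ t : ℝ) : L →ₗ[ℝ] Euc n where
  toFun J := ((J - π J : L) : ℝ → Euc n) t + dslope (π J : ℝ → Euc n) t₀ t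
  map_add' J₁ J₂ := by
    have h : dslope (π (J₁ + J₂) : ℝ → Euc n) t₀ t =
        dslope (π J₁ : ℝ → Euc n) t₀ t + dslope (π J₂ : ℝ → Euc n) t₀ t := by
      rcases eq_or_ne t t₀ with rfl | ht
      · simp only [dslope_same, map_add, Submodule.coe_add]
        exact deriv_add ((hL.jacobi _).1 t) ((hL.jacobi _).1 t)
      · simp only [dslope_of_ne _ ht, slope_def_module, map_add, Submodule.coe_add, Pi.add_apply]
        module
    rw [h]
    simp only [map_add, Submodule.coe_add, Submodule.coe_sub, Pi.add_apply, Pi.sub_apply]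
    module
  map_smul' c J := by
    have h : dslope (π (c • J) : ℝ → Euc n) t₀ t = c • dslope (π J : ℝ → Euc n) t₀ t := by
      rcases eq_or_ne t t₀ with rfl | ht
      · simp only [dslope_same, map_smul, Submodule.coe_smul]
        exact deriv_const_smul c ((hL.jacobi _).1 t)
      · simp only [dslope_of_ne _ ht, slope_def_module, map_smul, Submodule.coe_smul,
          Pi.smul_apply]
        module
    rw [h]
    simp only [map_smul, Submodule.coe_smul, Submodule.coe_sub, Pi.smul_apply, Pi.sub_apply,
      RingHom.id_apply]
    module

theorem regularEval_apply (hL : IsLagrangian R L) (π : L →ₗ[ℝ] L) (t₀ t : ℝ) (J : L) :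
    hL.regularEval π t₀ t J =
      ((J - π J : L) : ℝ → Euc n) t + dslope (π J : ℝ → Euc n) t₀ t := rfl

theorem continuous_regularEval (hL : IsLagrangian R L) (π : L →ₗ[ℝ] L) (t₀ : ℝ) (J : L) :
    Continuous fun t => hL.regularEval π t₀ t J := by
  have h : Continuous (dslope (π J : ℝ → Euc n) t₀) := by
    rw [← continuousOn_univ, continuousOn_dslope univ_mem]
    exact ⟨(hL.jacobi _).1.continuous.continuousOn, (hL.jacobi _).1 t₀⟩
  exact (hL.jacobi _).1.continuous.add h

/-- There is a projection of `L` onto the fields vanishing at `t₀`. -/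
theorem exists_projection (L : Submodule ℝ (ℝ → Euc n)) (t₀ : ℝ) :
    ∃ π : L →ₗ[ℝ] L, (∀ J, (π J : ℝ → Euc n) t₀ = 0) ∧
      ∀ J : L, (J : ℝ → Euc n) t₀ = 0 → π J = J := by
  let ev : L →ₗ[ℝ] Euc n := (LinearMap.proj t₀).comp L.subtype
  obtain ⟨g, hg⟩ : ∃ g : L →ₗ[ℝ] LinearMap.ker ev, g ∘ₗ (LinearMap.ker ev).subtype =
      LinearMap.id := LinearMap.exists_leftInverse_of_injective _ (Submodule.ker_subtype _)
  refine ⟨(LinearMap.ker ev).subtype.comp g, fun J => (g J).2, fun J hJ => ?_⟩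
  have := LinearMap.congr_fun hg ⟨J, hJ⟩
  exact congrArg Subtype.val this

theorem regularEval_injective (hL : IsLagrangian R L) (hR : Continuous R) {π : L →ₗ[ℝ] L} {t₀ : ℝ}
    (hπ : ∀ J, (π J : ℝ → Euc n) t₀ = 0)
    (hfix : ∀ J : L, (J : ℝ → Euc n) t₀ = 0 → π J = J) :
    Function.Injective (hL.regularEval π t₀ t₀) := by
  rw [injective_iff_map_eq_zero]
  intro J hJ
  rw [regularEval_apply, dslope_same] at hJ
  have horth : ⟪deriv (π J : ℝ → Euc n) t₀, ((J - π J : L) : ℝ → Euc n) t₀⟫ = 0 := by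
    rw [hL.isotropic, hπ, inner_zero_left]
  have hz : ((J - π J : L) : ℝ → Euc n) t₀ = 0 := by
    rw [eq_neg_of_add_eq_zero_right hJ, inner_neg_left, neg_eq_zero] at horth
    exact inner_self_eq_zero.1 horth
  have hJ0 : (J : ℝ → Euc n) t₀ = 0 := by
    simpa [hπ] using hz
  rw [hz, zero_add, hfix J hJ0] at hJ
  exact Subtype.ext ((hL.jacobi J).eq_zero_s13 hR hJ0 hJ)

theorem regularEval_surjective (hL : IsLagrangian R L) (hR : Continuous R) {π : L →ₗ[ℝ] L}
    {t₀ : ℝ} (hπ : ∀ J, (π J : ℝ → Euc n) t₀ = 0)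
    (hfix : ∀ J : L, (J : ℝ → Euc n) t₀ = 0 → π J = J) :
    Function.Surjective (hL.regularEval π t₀ t₀) := by
  have := hL.finiteDimensional
  exact (LinearMap.injective_iff_surjective_of_finrank_eq_finrank
    (by rw [hL.finrank_eq, finrank_euclideanSpace_fin])).1 (hL.regularEval_injective hR hπ hfix)

/-- `Y` minimizes the norm at `t` among the fields on which `Λ` takes the value one, and its
derivative at `t` is the value of a field in `L`, whose component in the kernel of `Λ` is `I`. -/
structure IsMinimizer (Λ : L →ₗ[ℝ] ℝ) (t : ℝ) (Y I : L) (a : ℝ) : Prop where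
  map_eq_one : Λ Y = 1
  map_eq_zero : Λ I = 0
  inner_eq : ∀ J : L, ⟪(Y : ℝ → Euc n) t, (J : ℝ → Euc n) t⟫ = Λ J * ‖(Y : ℝ → Euc n) t‖ ^ 2
  deriv_eq : deriv (Y : ℝ → Euc n) t = a • (Y : ℝ → Euc n) t + (I : ℝ → Euc n) t

theorem exists_isMinimizer (hL : IsLagrangian R L) (hR : Continuous R) {Λ : L →ₗ[ℝ] ℝ}
    (hΛ : Λ ≠ 0) (hvan : ∀ (J : L) (t : ℝ), (J : ℝ → Euc n) t = 0 → Λ J = 0) (t : ℝ) :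
    ∃ Y I a, IsMinimizer Λ t Y I a := by
  obtain ⟨J₀, hJ₀⟩ : ∃ J, Λ J = 1 := LinearMap.surjective hΛ 1
  let ev : L →ₗ[ℝ] Euc n := (LinearMap.proj t).comp L.subtype
  let W : Submodule ℝ (Euc n) := (LinearMap.ker Λ).map ev
  obtain ⟨I₀, hI₀, hI₀W⟩ : W.starProjection (ev J₀) ∈ W := W.starProjection_apply_mem _
  obtain ⟨π, hπ, hfix⟩ := exists_projection L t
  set Y₀ := J₀ - I₀ with hY₀
  have hY₀perp : ∀ I ∈ LinearMap.ker Λ, ⟪(Y₀ : ℝ → Euc n) t, (I : ℝ → Euc n) t⟫ = 0 := by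
    intro I hI
    have h := W.starProjection_inner_eq_zero (ev J₀) (ev I) ⟨I, hI, rfl⟩
    rw [← hI₀W] at h
    exact h
  obtain ⟨G, hG⟩ := hL.regularEval_surjective hR hπ hfix (deriv (Y₀ : ℝ → Euc n) t)
  rw [regularEval_apply, dslope_same] at hG
  have hΛπ : Λ (π G) = 0 := hvan _ t (hπ G)
  have hYt : ((Y₀ - π G : L) : ℝ → Euc n) t = (Y₀ : ℝ → Euc n) t := by
    simp [hπ]
  have hΛY : Λ (Y₀ - π G) = 1 := by
    rw [map_sub, hΛπ, hY₀, map_sub, hJ₀, LinearMap.mem_ker.1 hI₀]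
    norm_num
  clear_value Y₀
  refine ⟨Y₀ - π G, (G - π G) - Λ (G - π G) • (Y₀ - π G), Λ (G - π G), hΛY, ?_, ?_, ?_⟩
  · rw [map_sub Λ (G - π G), map_smul, hΛY]
    simp
  · intro J
    have h := hY₀perp (J - Λ J • (Y₀ - π G)) (by
      rw [LinearMap.mem_ker, map_sub, map_smul, hΛY]
      simp)
    rw [Submodule.coe_sub, Submodule.coe_smul, Pi.sub_apply, Pi.smul_apply, hYt,
      inner_sub_right, inner_smul_right, real_inner_self_eq_norm_sq] at h
    rw [hYt]
    linarith
  · have hd : deriv ((Y₀ - π G : L) : ℝ → Euc n) t =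
        deriv (Y₀ : ℝ → Euc n) t - deriv (π G : ℝ → Euc n) t :=
      deriv_sub ((hL.jacobi Y₀).1 t) ((hL.jacobi (π G)).1 t)
    rw [hd, ← hG]
    simp only [Submodule.coe_sub, Submodule.coe_smul, Pi.sub_apply, Pi.smul_apply]
    module

namespace IsMinimizer

variable {Λ : L →ₗ[ℝ] ℝ} {t : ℝ} {Y I : L} {a : ℝ}

theorem norm_pos (h : IsMinimizer Λ t Y I a)
    (hvan : ∀ (J : L) (t : ℝ), (J : ℝ → Euc n) t = 0 → Λ J = 0) :
    0 < ‖(Y : ℝ → Euc n) t‖ := by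
  rw [norm_pos_iff]
  intro h0
  have := hvan Y t h0
  rw [h.map_eq_one] at this
  exact one_ne_zero this

/-- Any vector whose inner product with the minimal value is its squared norm is no shorter. -/
theorem norm_le_of_inner_eq {E : Type*} [NormedAddCommGroup E] [InnerProductSpace ℝ E] {v w : E}
    (h : ⟪v, w⟫ = ‖v‖ ^ 2) : ‖v‖ ≤ ‖w‖ := by
  rcases (norm_nonneg v).eq_or_lt with h0 | h0
  · rw [← h0]
    exact norm_nonneg w
  · have := real_inner_le_norm v w
    nlinarith

theorem norm_le (h : IsMinimizer Λ t Y I a) {J : L} (hJ : Λ J = 1) :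
    ‖(Y : ℝ → Euc n) t‖ ≤ ‖(J : ℝ → Euc n) t‖ :=
  norm_le_of_inner_eq (by rw [h.inner_eq, hJ, one_mul])

/-- The norm of the variation `Y - (s - t) I` bounds the minimal norm from above to second order
at `t`. -/
theorem exists_variation (hL : IsLagrangian R L) (h : IsMinimizer Λ t Y I a) :
    ∃ ψ : ℝ → ℝ, Differentiable ℝ ψ ∧ DifferentiableAt ℝ (deriv ψ) t ∧
      (∀ s, ∃ J : L, Λ J = 1 ∧ ψ s = ‖(J : ℝ → Euc n) s‖ ^ 2) ∧
      ψ t = ‖(Y : ℝ → Euc n) t‖ ^ 2 ∧ deriv ψ t = 2 * a * ‖(Y : ℝ → Euc n) t‖ ^ 2 ∧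
      deriv (deriv ψ) t = 2 * a ^ 2 * ‖(Y : ℝ → Euc n) t‖ ^ 2 -
        2 * ⟪R t ((Y : ℝ → Euc n) t), (Y : ℝ → Euc n) t⟫ - 4 * ‖(I : ℝ → Euc n) t‖ ^ 2 := by
  obtain ⟨hY, hY', hYR⟩ := hL.jacobi Y
  obtain ⟨hI, hI', -⟩ := hL.jacobi I
  set y : ℝ → Euc n := (Y : ℝ → Euc n) with hy
  set i : ℝ → Euc n := (I : ℝ → Euc n) with hi
  let z : ℝ → Euc n := fun s => y s - (s - t) • i s
  let z' : ℝ → Euc n := fun s => deriv y s - ((s - t) • deriv i s + i s)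
  have hz : ∀ s, HasDerivAt z (z' s) s := by
    intro s
    have := (hY s).hasDerivAt.sub (((hasDerivAt_id s).sub_const t).smul (hI s).hasDerivAt)
    convert! this using 1
    simp only [z', id, one_smul]
  have hz' : HasDerivAt z' (deriv (deriv y) t - (2 : ℝ) • deriv i t) t := by
    have := (hY' t).hasDerivAt.sub
      ((((hasDerivAt_id t).sub_const t).smul (hI' t).hasDerivAt).add (hI t).hasDerivAt)
    convert! this using 1
    simp only [id, sub_self, zero_smul, one_smul, two_smul, zero_add]
  have hψ : ∀ s, HasDerivAt (fun s => ‖z s‖ ^ 2) (2 * ⟪z s, z' s⟫) s := fun s => (hz s).norm_sq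
  have hψ' : deriv (fun s => ‖z s‖ ^ 2) = fun s => 2 * ⟪z s, z' s⟫ := funext fun s => (hψ s).deriv
  have hψ'' := ((hz t).inner ℝ hz').const_mul 2
  have hzt : z t = y t := by simp [z]
  have hz't : z' t = a • y t := by
    simp only [z', sub_self, zero_smul, zero_add, h.deriv_eq, hy, hi, add_sub_cancel_right]
  have hperp : ⟪y t, i t⟫ = 0 := by rw [h.inner_eq, h.map_eq_zero, zero_mul]
  have hpair : ⟪y t, deriv i t⟫ = ‖i t‖ ^ 2 := by
    rw [← hL.isotropic Y I t, h.deriv_eq, inner_add_left, inner_smul_left, hperp, mul_zero,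
      zero_add, real_inner_self_eq_norm_sq]
  refine ⟨fun s => ‖z s‖ ^ 2, fun s => (hψ s).differentiableAt, ?_, ?_, ?_, ?_, ?_⟩
  · rw [hψ']
    exact hψ''.differentiableAt
  · refine fun s => ⟨Y - (s - t) • I, ?_, rfl⟩
    rw [map_sub, map_smul, h.map_eq_one, h.map_eq_zero, smul_zero, sub_zero]
  · simp only [hzt]
  · simp only [hψ']
    rw [hzt, hz't, inner_smul_right, real_inner_self_eq_norm_sq]
    ring
  · rw [hψ', hψ''.deriv, hzt, hz't, eq_neg_of_add_eq_zero_left (hYR t), inner_sub_right,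
      inner_neg_right, inner_smul_right, hpair, inner_smul_left, inner_smul_right,
      real_inner_self_eq_norm_sq, real_inner_comm (y t), conj_trivial]
    ring

end IsMinimizer

/-- The minimal norm of the fields on which `Λ` takes the value one is lower semicontinuous in
time, also across the zeros of fields in `L`. -/
theorem lowerSemicontinuous_norm (hL : IsLagrangian R L) (hR : Continuous R) {Λ : L →ₗ[ℝ] ℝ}
    (hvan : ∀ (J : L) (t : ℝ), (J : ℝ → Euc n) t = 0 → Λ J = 0) {Y I : ℝ → L} {a : ℝ → ℝ}
    (hY : ∀ t, IsMinimizer Λ t (Y t) (I t) (a t)) :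
    LowerSemicontinuous fun t => ‖(Y t : ℝ → Euc n) t‖ := by
  intro t₀ y hy
  have := hL.finiteDimensional
  obtain ⟨π, hπ, hfix⟩ := exists_projection L t₀
  let e : L ≃ₗ[ℝ] Euc n := LinearEquiv.ofBijective (hL.regularEval π t₀ t₀)
    ⟨hL.regularEval_injective hR hπ hfix, hL.regularEval_surjective hR hπ hfix⟩
  let C : ℝ → Euc n →L[ℝ] Euc n := fun t =>
    LinearMap.toContinuousLinearMap ((hL.regularEval π t₀ t).comp e.symm.toLinearMap)
  have hCe : ∀ t (G : L), C t (e G) = hL.regularEval π t₀ t G := by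
    intro t G
    simp [C]
  have hCcont : Continuous C :=
    continuous_clm_apply.2 fun v => hL.continuous_regularEval π t₀ (e.symm v)
  have hCt₀ : C t₀ = ContinuousLinearMap.id ℝ (Euc n) := by
    ext1 v
    obtain ⟨G, rfl⟩ := e.surjective v
    rw [hCe]
    rfl
  set f₀ := ‖(Y t₀ : ℝ → Euc n) t₀‖
  have hf₀ : 0 < f₀ := (hY t₀).norm_pos hvan
  have hlow : Tendsto (fun t => (1 - ‖C t - C t₀‖) * f₀) (𝓝 t₀) (𝓝 f₀) := by
    have : Continuous fun t => (1 - ‖C t - C t₀‖) * f₀ := by fun_prop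
    simpa using this.tendsto t₀
  have hsmall : ∀ᶠ t in 𝓝 t₀, 0 < 1 - ‖C t - C t₀‖ := by
    have : Continuous fun t => 1 - ‖C t - C t₀‖ := by fun_prop
    exact this.continuousAt.eventually (lt_mem_nhds (by simp))
  filter_upwards [hlow.eventually (lt_mem_nhds hy), hsmall] with t ht hpos
  refine ht.trans_le ?_
  set J := Y t
  have hππ : π (π J) = π J := hfix _ (hπ J)
  set G : L := J - π J + (t - t₀) • π J
  have hπG : π G = (t - t₀) • π J := by
    simp only [G, map_add, map_sub, map_smul, hππ, sub_self, zero_add]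
  have hval : hL.regularEval π t₀ t G = (J : ℝ → Euc n) t := by
    have hG : G - π G = J - π J := by simp only [hπG, G, add_sub_cancel_right]
    have hs : dslope ((t - t₀) • π J : L) t₀ t = (π J : ℝ → Euc n) t := by
      rcases eq_or_ne t t₀ with rfl | hne
      · rw [sub_self, zero_smul, dslope_same, hπ]
        exact deriv_const t 0
      · rw [dslope_of_ne _ hne, slope_def_module, Submodule.coe_smul, Pi.smul_apply,
          Pi.smul_apply, hπ, smul_zero, sub_zero, inv_smul_smul₀ (sub_ne_zero.2 hne)]
    rw [regularEval_apply, hG, hπG, hs, Submodule.coe_sub, Pi.sub_apply, sub_add_cancel]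
  have hΛG : Λ G = 1 := by
    rw [map_add, map_sub, map_smul, hvan (π J) t₀ (hπ J), (hY t).map_eq_one]
    simp
  have he : f₀ ≤ ‖e G‖ := by
    refine IsMinimizer.norm_le_of_inner_eq ?_
    change ⟪(Y t₀ : ℝ → Euc n) t₀, ((G - π G : L) : ℝ → Euc n) t₀ +
      dslope (π G : ℝ → Euc n) t₀ t₀⟫ = _
    rw [dslope_same, inner_add_right, (hY t₀).inner_eq, ← hL.isotropic, map_sub, hΛG,
      hvan (π G) t₀ (hπ G), hπ, inner_zero_right, sub_zero, one_mul, add_zero]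
  calc (1 - ‖C t - C t₀‖) * f₀ ≤ (1 - ‖C t - C t₀‖) * ‖e G‖ := by gcongr
    _ = ‖e G‖ - ‖C t - C t₀‖ * ‖e G‖ := by ring
    _ ≤ ‖e G‖ - ‖(C t - C t₀) (e G)‖ := by gcongr; exact (C t - C t₀).le_opNorm _
    _ ≤ ‖e G + (C t - C t₀) (e G)‖ := by
      have := norm_sub_le (e G + (C t - C t₀) (e G)) ((C t - C t₀) (e G))
      rw [add_sub_cancel_right] at this
      linarith
    _ = ‖(J : ℝ → Euc n) t‖ := by
      rw [sub_apply, hCt₀, ContinuousLinearMap.id_apply, add_sub_cancel, hCe,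
        hval]

/-- A nonzero functional on `L` that kills every field with a zero is nonzero on some parallel
field. -/
theorem exists_parallel (hL : IsLagrangian R L) (hR : Continuous R)
    (hsym : ∀ t : ℝ, ∀ v w : Euc n, ⟪R t v, w⟫ = ⟪v, R t w⟫)
    (hRpos : ∀ t : ℝ, ∀ v : Euc n, 0 ≤ ⟪R t v, v⟫) {Λ : L →ₗ[ℝ] ℝ} (hΛ : Λ ≠ 0)
    (hvan : ∀ (J : L) (t : ℝ), (J : ℝ → Euc n) t = 0 → Λ J = 0) :
    ∃ J : L, Λ J = 1 ∧ ∃ c : Euc n, (J : ℝ → Euc n) = fun _ => c := by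
  choose Y I a hY using hL.exists_isMinimizer hR hΛ hvan
  set ν : ℝ → Euc n := fun t => (Y t : ℝ → Euc n) t with hν
  have hpos : ∀ t, 0 < ‖ν t‖ := fun t => (hY t).norm_pos hvan
  have hconst : ∀ s t, ‖ν s‖ = ‖ν t‖ := by
    refine eq_of_isConcaveBarrier (hL.lowerSemicontinuous_norm hR hvan hY) hpos fun t => ?_
    obtain ⟨ψ, h₁, h₂, h₃, h₄, h₅, h₆⟩ := (hY t).exists_variation hL
    refine ⟨ψ, h₁, h₂, fun s => ?_, h₄, ?_⟩
    · obtain ⟨J, hJ, hs⟩ := h₃ s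
      rw [hs]
      gcongr
      exact (hY s).norm_le hJ
    · rw [h₄, h₅, h₆]
      have h := mul_nonneg (sq_nonneg ‖ν t‖) (hRpos t (ν t))
      have h' := mul_nonneg (sq_nonneg ‖ν t‖) (sq_nonneg ‖(I t : ℝ → Euc n) t‖)
      simp only [hν] at h h'
      nlinarith
  have hrigid : ∀ t, deriv (Y t : ℝ → Euc n) t = 0 ∧ R t (ν t) = 0 := by
    intro t
    obtain ⟨ψ, h₁, -, h₃, h₄, h₅, h₆⟩ := (hY t).exists_variation hL
    have hmin : IsLocalMin ψ t := by
      refine Eventually.of_forall fun s => ?_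
      obtain ⟨J, hJ, hs⟩ := h₃ s
      have h := (hY s).norm_le hJ
      have hst : ‖(Y t : ℝ → Euc n) t‖ = ‖(Y s : ℝ → Euc n) s‖ := hconst t s
      rw [h₄, hs, hst]
      gcongr
    have hfirst := hmin.deriv_eq_zero
    have hsecond := hmin.deriv_deriv_nonneg (h₁ t).continuousAt
    have hpt : 0 < ‖(Y t : ℝ → Euc n) t‖ := hpos t
    have ha : a t = 0 := by
      rw [h₅] at hfirst
      simpa [hpt.ne'] using hfirst
    rw [h₆, ha] at hsecond
    have hr : 0 ≤ ⟪R t ((Y t : ℝ → Euc n) t), (Y t : ℝ → Euc n) t⟫ := hRpos t _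
    have hI : ‖(I t : ℝ → Euc n) t‖ ^ 2 = 0 := by nlinarith [sq_nonneg ‖(I t : ℝ → Euc n) t‖]
    refine ⟨?_, apply_eq_zero_of_inner_self_eq_zero (hsym t) (hRpos t) ?_⟩
    · have hI0 : (I t : ℝ → Euc n) t = 0 := by simpa using hI
      rw [(hY t).deriv_eq, ha, zero_smul, hI0, zero_add]
    · change ⟪R t ((Y t : ℝ → Euc n) t), (Y t : ℝ → Euc n) t⟫ = 0
      nlinarith
  have hderiv : ∀ t, HasDerivAt ν 0 t := by
    intro t
    rw [hasDerivAt_iff_isLittleO, Asymptotics.isLittleO_iff]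
    intro η hη
    have hY2 : HasDerivAt (deriv (Y t : ℝ → Euc n)) 0 t := by
      have h := ((hL.jacobi (Y t)).2.1 t).hasDerivAt
      rwa [eq_neg_of_add_eq_zero_left ((hL.jacobi (Y t)).2.2 t),
        show R t ((Y t : ℝ → Euc n) t) = 0 from (hrigid t).2, neg_zero] at h
    have hε : 0 < η ^ 2 / (2 * ‖ν t‖) := by have := hpos t; positivity
    filter_upwards [eventually_norm_sub_le_mul_sq (hL.jacobi (Y t)).1 (hrigid t).1 hY2 hε]
      with s hs
    simp only [smul_zero, sub_zero]
    have h₁ : ⟪ν s, (Y t : ℝ → Euc n) s⟫ = ‖ν s‖ ^ 2 := by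
      rw [(hY s).inner_eq, (hY t).map_eq_one, one_mul]
    have h₂ : ‖ν s - ν t‖ ^ 2 = 2 * ⟪ν s, (Y t : ℝ → Euc n) s - (Y t : ℝ → Euc n) t⟫ := by
      rw [inner_sub_right, h₁, norm_sub_sq_real, ← hconst s t]
      ring
    have h₃ : ‖ν s - ν t‖ ^ 2 ≤ (η * ‖s - t‖) ^ 2 := by
      calc ‖ν s - ν t‖ ^ 2
          ≤ 2 * (‖ν s‖ * ‖(Y t : ℝ → Euc n) s - (Y t : ℝ → Euc n) t‖) := by
            rw [h₂]
            gcongr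
            exact real_inner_le_norm _ _
        _ ≤ 2 * (‖ν t‖ * (η ^ 2 / (2 * ‖ν t‖) * ‖s - t‖ ^ 2)) := by
            rw [hconst s t]
            gcongr
        _ = (η * ‖s - t‖) ^ 2 := by
            have := (hpos t).ne'
            field_simp
    exact (pow_le_pow_iff_left₀ (norm_nonneg _) (by positivity) two_ne_zero).1 h₃
  have hνc : ∀ t, ν t = ν 0 := fun t =>
    is_const_of_deriv_eq_zero (fun s => (hderiv s).differentiableAt) (fun s => (hderiv s).deriv) t 0
  refine ⟨Y 0, (hY 0).map_eq_one, ν 0, ?_⟩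
  obtain ⟨hd, hdd, hJ⟩ := hL.jacobi (Y 0)
  have hder : deriv (fun t => (Y 0 : ℝ → Euc n) t - ν 0) = deriv (Y 0 : ℝ → Euc n) :=
    funext fun t => deriv_sub_const _
  have hdiff : IsJacobi R fun t => (Y 0 : ℝ → Euc n) t - ν 0 := by
    refine ⟨hd.sub_const _, by rwa [hder], fun t => ?_⟩
    rw [hder, map_sub, ← hνc t, (hrigid t).2, sub_zero, hJ t]
  have hzero := hdiff.eq_zero_s13 hR (t₀ := 0) (sub_self _) (by rw [hder]; exact (hrigid 0).1)
  funext t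
  exact sub_eq_zero.1 (congrFun hzero t)

end IsLagrangian

theorem stmt_13 {n : ℕ} (hn : 1 ≤ n) (R : ℝ → (Euc n →L[ℝ] Euc n))
    (hRcont : Continuous R)
    (hRsym : ∀ t : ℝ, ∀ v w : Euc n, ⟪R t v, w⟫ = ⟪v, R t w⟫)
    (hRpos : ∀ t : ℝ, ∀ v : Euc n, 0 ≤ ⟪R t v, v⟫)
    (L : Submodule ℝ (ℝ → Euc n))
    (hLJ : ∀ J ∈ L, IsJacobi R J)
    (hiso : ∀ J₁ ∈ L, ∀ J₂ ∈ L, om J₁ J₂ 0 = 0)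
    (hdim : Module.finrank ℝ L = n) :
    Submodule.span ℝ {J : ℝ → Euc n | J ∈ L ∧ ∃ t : ℝ, J t = 0} ⊓
      Submodule.span ℝ {J : ℝ → Euc n | J ∈ L ∧ ∃ c : Euc n, J = fun _ => c} = ⊥ ∧
    Submodule.span ℝ {J : ℝ → Euc n | J ∈ L ∧ ∃ t : ℝ, J t = 0} ⊔
      Submodule.span ℝ {J : ℝ → Euc n | J ∈ L ∧ ∃ c : Euc n, J = fun _ => c} = L := by
  have hL : IsLagrangian R L :=
    { jacobi := fun J => hLJ J J.2
      isotropic := fun J₁ J₂ t => by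
        have h := om_eq_om_zero hRsym (hLJ J₁ J₁.2) (hLJ J₂ J₂.2) t
        rw [hiso J₁ J₁.2 J₂ J₂.2] at h
        exact sub_eq_zero.1 h
      finiteDimensional := Module.finite_of_finrank_pos (by omega)
      finrank_eq := hdim }
  set V : Submodule ℝ (ℝ → Euc n) := Submodule.span ℝ {J | J ∈ L ∧ ∃ t : ℝ, J t = 0}
  set P : Submodule ℝ (ℝ → Euc n) := Submodule.span ℝ {J | J ∈ L ∧ ∃ c : Euc n, J = fun _ => c}
  have hVL : V ≤ L := Submodule.span_le.2 fun J hJ => hJ.1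
  have hPL : P ≤ L := Submodule.span_le.2 fun J hJ => hJ.1
  have hPconst : ∀ J ∈ P, ∃ c : Euc n, J = fun _ => c := by
    intro J hJ
    refine Submodule.span_induction (fun _ h => h.2) ⟨0, rfl⟩ ?_ ?_ hJ
    · rintro _ _ _ _ ⟨c, rfl⟩ ⟨d, rfl⟩
      exact ⟨c + d, rfl⟩
    · rintro r _ _ ⟨c, rfl⟩
      exact ⟨r • c, rfl⟩
  refine ⟨(Submodule.eq_bot_iff _).2 ?_, le_antisymm (sup_le hVL hPL) ?_⟩
  · rintro J ⟨hJV, hJP⟩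
    obtain ⟨c, rfl⟩ := hPconst J hJP
    have hperp : ∀ K ∈ V, ∀ t, ⟪K t, c⟫ = 0 := by
      intro K hK
      refine Submodule.span_induction ?_ (by simp) ?_ ?_ hK
      · rintro K ⟨hKL, t₀, ht₀⟩ t
        have hd : ∀ s, HasDerivAt (fun s => ⟪K s, c⟫) 0 s := by
          intro s
          have h := ((hLJ K hKL).1 s).hasDerivAt.inner ℝ (hasDerivAt_const s c)
          have h' := hL.isotropic ⟨K, hKL⟩ ⟨_, hPL hJP⟩ s
          simp only [deriv_const, inner_zero_right] at h'
          simpa only [inner_zero_right, h', zero_add] using h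
        have h := is_const_of_deriv_eq_zero (fun s => (hd s).differentiableAt)
          (fun s => (hd s).deriv) t t₀
        simpa [ht₀] using h
      · intro K₁ K₂ _ _ h₁ h₂ t
        rw [Pi.add_apply, inner_add_left, h₁, h₂, add_zero]
      · intro r K _ h t
        rw [Pi.smul_apply, inner_smul_left, h, mul_zero]
    have hc : c = 0 := inner_self_eq_zero.1 (hperp _ hJV 0)
    rw [hc]
    rfl
  · by_contra hnot
    have hlt : (V ⊔ P).comap L.subtype < ⊤ := by
      rw [lt_top_iff_ne_top]
      intro htop
      exact hnot (Submodule.comap_subtype_eq_top.1 htop)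
    obtain ⟨Λ, hΛ, hker⟩ := Submodule.exists_le_ker_of_lt_top _ hlt
    obtain ⟨J, hJ, c, hc⟩ := hL.exists_parallel hRcont hRsym hRpos hΛ fun J t ht =>
      hker (Submodule.mem_sup_left (Submodule.subset_span ⟨J.2, t, ht⟩))
    have hJ0 : Λ J = 0 :=
      hker (Submodule.mem_sup_right (Submodule.subset_span ⟨J.2, c, hc⟩))
    exact one_ne_zero (hJ.symm.trans hJ0)
end
end
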